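/- arXiv:2005.10773 — 3 statements merged into one kernel-verified Lean document; each statement's English description precedes it below -/
import Mathlib

section
/- For every natural number n ≥ 1, the map Φ from the cube [0,n]^n to the set 𝒟 of persistence diagrams, sending (t_1,…,t_n) to the persistence diagram whose support consists of the n points p_i = (i(n+1)−1, i(n+1)+n+t_i) for i = 1,…,n, each with multiplicity 1, satisfies d(Φ(t), Φ(s)) = max_{1≤i≤n} |t_i − s_i| for all t, s ∈ [0,n]^n; that is, Φ is an isometric embedding of the cube [0,n]^n equipped with the ℓ∞ (sup) metric into 𝒟 equipped with the bottleneck metric d. -/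
noncomputable section

/-- The sup-norm distance on `ℝ²`. -/
def supDist (a b : ℝ × ℝ) : ℝ := max |a.1 - b.1| |a.2 - b.2|

/-- `X = {(x,y) : 0 ≤ x < y}`, the open upper half-triangle (off-diagonal points). -/
def offDiag : Set (ℝ × ℝ) := {p | 0 ≤ p.1 ∧ p.1 < p.2}

/-- `Δ = {(x,y) : 0 ≤ x = y}`, the diagonal. -/
def diagSet : Set (ℝ × ℝ) := {p | 0 ≤ p.1 ∧ p.1 = p.2}

/-- A persistence diagram: an `ℕ`-valued function on `ℝ²` with finite support
contained in `X`. -/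
structure PersDiag where
  toFun : ℝ × ℝ → ℕ
  finite_support : (Function.support toFun).Finite
  support_subset : Function.support toFun ⊆ offDiag

/-- A sequential representation of a persistence diagram `μ`: a finite sequence of
points of `X ∪ Δ` such that every point of `X` occurs exactly `μ a` times
(the remaining terms then automatically lie in `Δ`). -/
def IsSeqRep (μ : PersDiag) {k : ℕ} (a : Fin k → ℝ × ℝ) : Prop :=
  (∀ i, a i ∈ offDiag ∪ diagSet) ∧
  (∀ p ∈ offDiag, {i : Fin k | a i = p}.ncard = μ.toFun p)

/-- The bottleneck distance between two persistence diagrams: the infimum, over all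
pairs of equal-length sequential representations and all permutations (matchings),
of the maximum of the sup-norm distances of matched points. -/
def bottleneck (μ ν : PersDiag) : ℝ :=
  sInf {r : ℝ | ∃ (k : ℕ) (a b : Fin k → ℝ × ℝ) (σ : Equiv.Perm (Fin k)),
    IsSeqRep μ a ∧ IsSeqRep ν b ∧ r = ⨆ i, supDist (a i) (b (σ i))}

/-- The topology of the bottleneck metric on the set of persistence diagrams:
the topology generated by the open balls of the bottleneck distance. -/
instance : TopologicalSpace PersDiag :=
  TopologicalSpace.generateFrom
    {U | ∃ (μ : PersDiag) (ε : ℝ), 0 < ε ∧ U = {ν | bottleneck μ ν < ε}}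

/-- The closed triangle `X̂ₙ = {(x,y) : 0 ≤ x ≤ y ≤ n}`. -/
def triangle (n : ℕ) : Set (ℝ × ℝ) := {p | 0 ≤ p.1 ∧ p.1 ≤ p.2 ∧ p.2 ≤ n}

/-- `𝒟ₙ`: persistence diagrams with at most `n` points of support, all lying in `X̂ₙ`. -/
def DD (n : ℕ) : Set PersDiag :=
  {μ | (Function.support μ.toFun).ncard ≤ n ∧ Function.support μ.toFun ⊆ triangle n}

/-- The point `pᵢ = (i(n+1) - 1, i(n+1) + n + tᵢ)` (here `i` ranges over `Fin n`,
corresponding to `i+1` in `{1,…,n}`). -/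
def cubePoint (n : ℕ) (t : Fin n → ℝ) (i : Fin n) : ℝ × ℝ :=
  (((i : ℕ) + 1) * ((n : ℝ) + 1) - 1, ((i : ℕ) + 1) * ((n : ℝ) + 1) + (n : ℝ) + t i)

/-- The map `Φ` from the cube `[0,n]ⁿ` to persistence diagrams: `Φ t` is the diagram
whose support consists of the points `cubePoint n t i`, each with multiplicity `1`. -/
def Phi (n : ℕ) (t : Fin n → ℝ) (ht : ∀ i, t i ∈ Set.Icc (0 : ℝ) (n : ℝ)) : PersDiag where
  toFun p := {i : Fin n | cubePoint n t i = p}.ncard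
  finite_support := by
    apply Set.Finite.subset (Set.finite_range (cubePoint n t))
    intro p hp
    obtain ⟨i, hi⟩ := Set.nonempty_of_ncard_ne_zero hp
    exact ⟨i, hi⟩
  support_subset := by
    intro p hp
    obtain ⟨i, hi⟩ := Set.nonempty_of_ncard_ne_zero hp
    rw [← hi]
    have h0 : (0 : ℝ) ≤ (i : ℕ) := Nat.cast_nonneg _
    have h1 : (0 : ℝ) ≤ (n : ℝ) := Nat.cast_nonneg _
    have h2 : (0 : ℝ) ≤ t i := (ht i).1
    constructor
    · simp only [cubePoint]
      nlinarith
    · simp only [cubePoint]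
      nlinarith

theorem supDist_nonneg (a b : ℝ × ℝ) : 0 ≤ supDist a b :=
  le_max_of_le_left (abs_nonneg _)

theorem supDist_comm (a b : ℝ × ℝ) : supDist a b = supDist b a := by
  simp only [supDist, abs_sub_comm]

theorem supDist_cubePoint (n : ℕ) (t s : Fin n → ℝ) (i : Fin n) :
    supDist (cubePoint n t i) (cubePoint n s i) = |t i - s i| := by
  simp [supDist, cubePoint]

theorem add_one_le_supDist_cubePoint (n : ℕ) (t s : Fin n → ℝ) {i j : Fin n} (hij : i ≠ j) :
    (n : ℝ) + 1 ≤ supDist (cubePoint n t i) (cubePoint n s j) := by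
  have hn : (0 : ℝ) ≤ n := Nat.cast_nonneg _
  refine le_max_of_le_left ?_
  simp only [cubePoint]
  rcases lt_or_gt_of_ne (Fin.val_ne_of_ne hij) with h | h
  · have h' : ((i : ℕ) : ℝ) + 1 ≤ (j : ℕ) := by exact_mod_cast h
    refine le_trans ?_ (neg_le_abs _)
    nlinarith
  · have h' : ((j : ℕ) : ℝ) + 1 ≤ (i : ℕ) := by exact_mod_cast h
    refine le_trans ?_ (le_abs_self _)
    nlinarith

theorem sub_le_two_mul_supDist_of_mem_diagSet (p : ℝ × ℝ) {q : ℝ × ℝ} (hq : q ∈ diagSet) :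
    p.2 - p.1 ≤ 2 * supDist p q := by
  have h1 : |p.1 - q.1| ≤ supDist p q := le_max_left _ _
  have h2 : |p.2 - q.2| ≤ supDist p q := le_max_right _ _
  have h3 : q.1 = q.2 := hq.2
  linarith [neg_abs_le (p.1 - q.1), le_abs_self (p.2 - q.2)]

theorem ncard_fiber_ne_zero {ι α : Type*} [Finite ι] (f : ι → α) (i : ι) :
    {j | f j = f i}.ncard ≠ 0 :=
  Set.ncard_ne_zero_of_mem (a := i) rfl (Set.toFinite _)

theorem isSeqRep_cubePoint (n : ℕ) (t : Fin n → ℝ)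
    (ht : ∀ i, t i ∈ Set.Icc (0 : ℝ) (n : ℝ)) : IsSeqRep (Phi n t ht) (cubePoint n t) := by
  refine ⟨fun i => Or.inl ((Phi n t ht).support_subset ?_), fun p _ => rfl⟩
  exact ncard_fiber_ne_zero (cubePoint n t) i

theorem IsSeqRep.mem_diagSet_or_eq_cubePoint {n k : ℕ} {t : Fin n → ℝ}
    {ht : ∀ i, t i ∈ Set.Icc (0 : ℝ) (n : ℝ)} {a : Fin k → ℝ × ℝ}
    (ha : IsSeqRep (Phi n t ht) a) (j : Fin k) :
    a j ∈ diagSet ∨ ∃ i, cubePoint n t i = a j := by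
  rcases ha.1 j with h | h
  · right
    have hpos := ncard_fiber_ne_zero a j
    rw [ha.2 _ h] at hpos
    exact Set.nonempty_of_ncard_ne_zero hpos
  · exact Or.inl h

theorem IsSeqRep.exists_eq_cubePoint {n k : ℕ} {t : Fin n → ℝ}
    {ht : ∀ i, t i ∈ Set.Icc (0 : ℝ) (n : ℝ)} {a : Fin k → ℝ × ℝ}
    (ha : IsSeqRep (Phi n t ht) a) (i : Fin n) : ∃ j, a j = cubePoint n t i := by
  have hpos : (Phi n t ht).toFun (cubePoint n t i) ≠ 0 :=
    ncard_fiber_ne_zero (cubePoint n t) i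
  rw [← ha.2 _ ((Phi n t ht).support_subset hpos)] at hpos
  exact Set.nonempty_of_ncard_ne_zero hpos

/-- A point of `Φ t` with the larger coordinate `t i ≥ s i` is at distance at least `|t i - s i|`
from the diagonal and from every point of `Φ s`. -/
theorem abs_sub_le_supDist_cubePoint {n : ℕ} {t s : Fin n → ℝ}
    (ht : ∀ i, t i ∈ Set.Icc (0 : ℝ) (n : ℝ)) (hs : ∀ i, s i ∈ Set.Icc (0 : ℝ) (n : ℝ))
    {i : Fin n} (hi : s i ≤ t i) {q : ℝ × ℝ}
    (hq : q ∈ diagSet ∨ ∃ j, cubePoint n s j = q) :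
    |t i - s i| ≤ supDist (cubePoint n t i) q := by
  have h1 := (ht i).2
  have h2 := (hs i).1
  rcases hq with hq | ⟨j, rfl⟩
  · have h := sub_le_two_mul_supDist_of_mem_diagSet (cubePoint n t i) hq
    rw [abs_of_nonneg (sub_nonneg.2 hi)]
    simp only [cubePoint] at h ⊢
    linarith
  · by_cases hij : i = j
    · subst hij
      exact (supDist_cubePoint n t s i).ge
    · have h := add_one_le_supDist_cubePoint n t s hij
      rw [abs_of_nonneg (sub_nonneg.2 hi)]
      linarith

/-- `Φ` is an isometric embedding of the cube `[0,n]ⁿ` with the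
`ℓ∞` metric into the persistence diagrams with the bottleneck metric:
`d(Φ t, Φ s) = max_{1 ≤ i ≤ n} |tᵢ - sᵢ|`. -/
theorem phi_isometric (n : ℕ) (hn : 1 ≤ n)
    (t s : Fin n → ℝ)
    (ht : ∀ i, t i ∈ Set.Icc (0 : ℝ) (n : ℝ)) (hs : ∀ i, s i ∈ Set.Icc (0 : ℝ) (n : ℝ)) :
    bottleneck (Phi n t ht) (Phi n s hs) = ⨆ i, |t i - s i| := by
  have key : ∀ r ∈ {r : ℝ | ∃ (k : ℕ) (a b : Fin k → ℝ × ℝ) (σ : Equiv.Perm (Fin k)),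
      IsSeqRep (Phi n t ht) a ∧ IsSeqRep (Phi n s hs) b ∧ r = ⨆ i, supDist (a i) (b (σ i))},
      ⨆ i, |t i - s i| ≤ r := by
    rintro r ⟨k, a, b, σ, ha, hb, rfl⟩
    have hle (j : Fin k) : supDist (a j) (b (σ j)) ≤ ⨆ i, supDist (a i) (b (σ i)) :=
      le_ciSup (f := fun i => supDist (a i) (b (σ i))) (Set.finite_range _).bddAbove j
    refine Real.iSup_le (fun i => ?_) (Real.iSup_nonneg fun _ => supDist_nonneg _ _)
    rcases le_total (s i) (t i) with hi | hi
    · obtain ⟨j, hj⟩ := ha.exists_eq_cubePoint i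
      refine le_trans ?_ (hle j)
      rw [hj]
      exact abs_sub_le_supDist_cubePoint ht hs hi (hb.mem_diagSet_or_eq_cubePoint _)
    · obtain ⟨j, hj⟩ := hb.exists_eq_cubePoint i
      refine le_trans ?_ (hle (σ.symm j))
      rw [Equiv.apply_symm_apply, hj, supDist_comm, abs_sub_comm]
      exact abs_sub_le_supDist_cubePoint hs ht hi (ha.mem_diagSet_or_eq_cubePoint _)
  refine IsLeast.csInf_eq ⟨⟨n, cubePoint n t, cubePoint n s, Equiv.refl _,
    isSeqRep_cubePoint n t ht, isSeqRep_cubePoint n s hs, ?_⟩, key⟩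
  simp only [Equiv.refl_apply, supDist_cubePoint]
end
end

section
/- For every n ≥ 1, the map ξ_n : (X̂_n)^n → 𝒟_n, which sends an n-tuple (a_1,…,a_n) of points of the triangle X̂_n to the persistence diagram μ defined by μ(a) = |{i : a_i = a}| for a ∈ X (off-diagonal points) and μ(a) = 0 otherwise, is continuous, where (X̂_n)^n carries the Euclidean product topology and 𝒟_n carries the topology of the bottleneck metric. -/
noncomputable section

open Classical in
/-- The map `ξₙ` sending an `n`-tuple of points of the triangle `X̂ₙ` to the persistence
diagram counting, at each off-diagonal point, the number of coordinates equal to it. -/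
def xi (n : ℕ) (a : Fin n → (triangle n)) : PersDiag where
  toFun p := if p ∈ offDiag then {i : Fin n | (a i : ℝ × ℝ) = p}.ncard else 0
  finite_support := by
    apply Set.Finite.subset (Set.finite_range (fun i => (a i : ℝ × ℝ)))
    intro p hp
    have hp' : (if p ∈ offDiag then {i : Fin n | (a i : ℝ × ℝ) = p}.ncard else 0) ≠ 0 := hp
    by_cases h : p ∈ offDiag
    · rw [if_pos h] at hp'
      obtain ⟨i, hi⟩ := Set.nonempty_of_ncard_ne_zero hp'
      exact ⟨i, hi⟩
    · rw [if_neg h] at hp'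
      exact absurd rfl hp'
  support_subset := by
    intro p hp
    have hp' : (if p ∈ offDiag then {i : Fin n | (a i : ℝ × ℝ) = p}.ncard else 0) ≠ 0 := hp
    by_cases h : p ∈ offDiag
    · exact h
    · rw [if_neg h] at hp'
      exact absurd rfl hp'

lemma xi_mem_DD (n : ℕ) (a : Fin n → (triangle n)) : xi n a ∈ DD n := by
  classical
  have hsub : Function.support (xi n a).toFun ⊆ Set.range (fun i => (a i : ℝ × ℝ)) := by
    intro p hp
    have hp' : (if p ∈ offDiag then {i : Fin n | (a i : ℝ × ℝ) = p}.ncard else 0) ≠ 0 := hp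
    by_cases h : p ∈ offDiag
    · rw [if_pos h] at hp'
      obtain ⟨i, hi⟩ := Set.nonempty_of_ncard_ne_zero hp'
      exact ⟨i, hi⟩
    · rw [if_neg h] at hp'
      exact absurd rfl hp'
  constructor
  · calc (Function.support (xi n a).toFun).ncard
        ≤ (Set.range (fun i => (a i : ℝ × ℝ))).ncard :=
          Set.ncard_le_ncard hsub (Set.finite_range _)
      _ ≤ n := by
          rw [← Set.image_univ]
          calc ((fun i => (a i : ℝ × ℝ)) '' Set.univ).ncard
              ≤ (Set.univ : Set (Fin n)).ncard := Set.ncard_image_le Set.finite_univ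
            _ = n := by simp [Set.ncard_univ]
  · intro p hp
    obtain ⟨i, hi⟩ := hsub hp
    rw [← hi]
    exact (a i).2

lemma triangle_subset (n : ℕ) : triangle n ⊆ offDiag ∪ diagSet := by
  rintro p ⟨h0, h1, -⟩
  rcases h1.lt_or_eq with h | h
  · exact Or.inl ⟨h0, h⟩
  · exact Or.inr ⟨h0, h⟩

/-- The costs of all matchings between sequential representations of `μ` and `ν`. -/
def matchingCosts (μ ν : PersDiag) : Set ℝ :=
  {r : ℝ | ∃ (k : ℕ) (a b : Fin k → ℝ × ℝ) (σ : Equiv.Perm (Fin k)),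
    IsSeqRep μ a ∧ IsSeqRep ν b ∧ r = ⨆ i, supDist (a i) (b (σ i))}

lemma bottleneck_eq_sInf (μ ν : PersDiag) : bottleneck μ ν = sInf (matchingCosts μ ν) := rfl

lemma matchingCosts_nonneg {μ ν : PersDiag} {r : ℝ} (hr : r ∈ matchingCosts μ ν) : 0 ≤ r := by
  obtain ⟨k, a, b, σ, -, -, rfl⟩ := hr
  exact Real.iSup_nonneg fun i => (dist_nonneg : 0 ≤ dist (a i) (b (σ i)))

lemma bddBelow_matchingCosts (μ ν : PersDiag) : BddBelow (matchingCosts μ ν) :=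
  ⟨0, fun _ => matchingCosts_nonneg⟩

lemma ncard_fiber_comp_equiv {ι κ α : Type*} (e : κ ≃ ι) (f : ι → α) (p : α) :
    {i | f (e i) = p}.ncard = {i | f i = p}.ncard := by
  rw [← Set.ncard_image_of_injective _ e.injective]
  congr 1
  ext i
  simp only [Set.mem_image, Set.mem_ofPred_eq]
  exact ⟨by rintro ⟨j, hj, rfl⟩; exact hj, fun h => ⟨e.symm i, by simpa using h, by simp⟩⟩

lemma IsSeqRep.comp_equiv {ι : Type*} {μ : PersDiag} {f : ι → ℝ × ℝ}
    (hf : ∀ i, f i ∈ offDiag ∪ diagSet) (hμ : ∀ p ∈ offDiag, {i | f i = p}.ncard = μ.toFun p)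
    {k : ℕ} (e : Fin k ≃ ι) : IsSeqRep μ (fun i => f (e i)) :=
  ⟨fun i => hf (e i), fun p hp => (ncard_fiber_comp_equiv e f p).trans (hμ p hp)⟩

/-- Two families indexed by the same finite type which represent `μ` and `ν` and stay within
distance `R` yield a matching of cost at most `R`. -/
lemma exists_matchingCosts_le {ι : Type*} [Finite ι] {μ ν : PersDiag} {f g : ι → ℝ × ℝ} {R : ℝ}
    (hf : ∀ i, f i ∈ offDiag ∪ diagSet) (hμ : ∀ p ∈ offDiag, {i | f i = p}.ncard = μ.toFun p)
    (hg : ∀ i, g i ∈ offDiag ∪ diagSet) (hν : ∀ p ∈ offDiag, {i | g i = p}.ncard = ν.toFun p)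
    (hR : 0 ≤ R) (hfg : ∀ i, dist (f i) (g i) ≤ R) : ∃ r ∈ matchingCosts μ ν, r ≤ R := by
  obtain ⟨k, ⟨e⟩⟩ := Finite.exists_equiv_fin ι
  exact ⟨_, ⟨k, _, _, 1, IsSeqRep.comp_equiv hf hμ e.symm, IsSeqRep.comp_equiv hg hν e.symm, rfl⟩,
    Real.iSup_le (fun i => hfg _) hR⟩

/-- Families taking each value of `s` equally often can be matched over `s`. -/
lemma exists_equiv_of_ncard_fiber_eq {ι κ α : Type*} [Finite ι] [Finite κ] {s : Set α}
    {f : ι → α} {g : κ → α} (h : ∀ p ∈ s, {i | f i = p}.ncard = {j | g j = p}.ncard) :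
    ∃ φ : {i // f i ∈ s} ≃ {j // g j ∈ s}, ∀ i, g (φ i) = f i := by
  have key : ∀ p : α,
      Nonempty ({i : {i // f i ∈ s} // f i = p} ≃ {j : {j // g j ∈ s} // g j = p}) := by
    intro p
    by_cases hp : p ∈ s
    · have h1 : Nonempty ({i // f i = p} ≃ {j // g j = p}) := Finite.card_eq.1 (h p hp)
      obtain ⟨e⟩ := h1
      exact ⟨((Equiv.subtypeSubtypeEquivSubtype (fun {i} hi => by rwa [hi])).trans e).trans
        (Equiv.subtypeSubtypeEquivSubtype (fun {j} hj => by rwa [hj])).symm⟩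
    · have : IsEmpty {i : {i // f i ∈ s} // f i = p} := ⟨fun i => hp (i.2 ▸ i.1.2)⟩
      have : IsEmpty {j : {j // g j ∈ s} // g j = p} := ⟨fun j => hp (j.2 ▸ j.1.2)⟩
      exact ⟨Equiv.equivOfIsEmpty _ _⟩
  let e := fun p => (key p).some
  exact ⟨Equiv.ofFiberEquiv (f := fun i : {i // f i ∈ s} => f i)
    (g := fun j : {j // g j ∈ s} => g j) e, fun i => Equiv.ofFiberEquiv_map e i⟩

lemma xi_apply {n : ℕ} (a : Fin n → triangle n) {p : ℝ × ℝ} (hp : p ∈ offDiag) :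
    (xi n a).toFun p = {i : Fin n | (a i : ℝ × ℝ) = p}.ncard := if_pos hp

/-- Moving the points of a tuple by at most `δ` increases matching costs by at most `δ`. -/
lemma exists_matchingCosts_xi_le {n : ℕ} {μ : PersDiag} {a b : Fin n → triangle n} {r δ : ℝ}
    (hr : r ∈ matchingCosts μ (xi n a)) (hδ : 0 ≤ δ) (hab : ∀ j, dist (a j) (b j) ≤ δ) :
    ∃ r' ∈ matchingCosts μ (xi n b), r' ≤ r + δ := by
  classical
  have hr0 := matchingCosts_nonneg hr
  obtain ⟨k, c, d', σ, ⟨hc, hcμ⟩, ⟨hd', hdν'⟩, rfl⟩ := hr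
  set r := ⨆ i, supDist (c i) (d' (σ i))
  obtain ⟨hd, hdν⟩ := IsSeqRep.comp_equiv hd' hdν' σ
  set d : Fin k → ℝ × ℝ := fun i => d' (σ i)
  have hcd : ∀ i, dist (c i) (d i) ≤ r := fun i =>
    le_ciSup (f := fun i => supDist (c i) (d' (σ i))) (Set.finite_range _).bddAbove i
  obtain ⟨φ, hφ⟩ := exists_equiv_of_ncard_fiber_eq (s := offDiag) (f := d)
    (g := fun j => (a j : ℝ × ℝ)) fun p hp => (hdν p hp).trans (xi_apply a hp)
  let f : {i // d i ∉ offDiag} ⊕ Fin n → ℝ × ℝ := Sum.elim (fun i => c i)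
    fun j => if h : (a j : ℝ × ℝ) ∈ offDiag then c (φ.symm ⟨j, h⟩) else a j
  let g : {i // d i ∉ offDiag} ⊕ Fin n → ℝ × ℝ := Sum.elim (fun i => d i) fun j => b j
  let emb : Fin k → {i // d i ∉ offDiag} ⊕ Fin n := fun i =>
    if h : d i ∈ offDiag then Sum.inr (φ ⟨i, h⟩) else Sum.inl ⟨i, h⟩
  have emb_inj : Function.Injective emb := by
    intro i i' h
    by_cases h1 : d i ∈ offDiag <;> by_cases h2 : d i' ∈ offDiag <;>
      simp only [emb, h1, h2, dif_pos, dif_neg, not_false_eq_true, reduceCtorEq, Sum.inr.injEq,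
        Sum.inl.injEq, Subtype.mk.injEq] at h
    · exact congrArg Subtype.val (φ.injective (Subtype.ext h))
    · exact h
  have f_emb : ∀ i, f (emb i) = c i := by
    intro i
    by_cases h : d i ∈ offDiag
    · simp [emb, f, h, (φ ⟨i, h⟩).2]
    · simp [emb, f, h]
  refine exists_matchingCosts_le (f := f) (g := g) ?_ ?_ ?_ ?_ (by positivity) ?_
  · rintro (i | j)
    · exact hc i
    · by_cases h : (a j : ℝ × ℝ) ∈ offDiag
      · simpa [f, h] using hc _
      · simpa only [f, h, Sum.elim_inr, dif_neg, not_false_eq_true] using triangle_subset n (a j).2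
  · intro p hp
    rw [← hcμ p hp, ← Set.ncard_image_of_injective _ emb_inj]
    congr 1
    ext x
    constructor
    · intro hx
      suffices ∃ i, emb i = x by
        obtain ⟨i, rfl⟩ := this
        exact ⟨i, (f_emb i).symm.trans hx, rfl⟩
      rcases x with i | j
      · exact ⟨i, by simp [emb, i.2]⟩
      · by_cases h : (a j : ℝ × ℝ) ∈ offDiag
        · exact ⟨φ.symm ⟨j, h⟩, by simp [emb, (φ.symm ⟨j, h⟩).2]⟩
        · have hx' : (a j : ℝ × ℝ) = p := by simpa [f, h] using hx
          exact absurd (hx' ▸ hp) h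
    · rintro ⟨i, hi, rfl⟩
      exact (f_emb i).trans hi
  · rintro (i | j)
    · exact hd i
    · exact triangle_subset n (b j).2
  · intro p hp
    rw [xi_apply b hp, ← Set.ncard_image_of_injective {j | (b j : ℝ × ℝ) = p}
      (Sum.inr_injective (α := {i // d i ∉ offDiag}))]
    congr 1
    ext x
    rcases x with i | j
    · have : d i ≠ p := fun h => i.2 (h ▸ hp)
      simp [g, this]
    · simp [g]
  · rintro (i | j)
    · exact (hcd i).trans (le_add_of_nonneg_right hδ)
    · by_cases h : (a j : ℝ × ℝ) ∈ offDiag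
      · have h1 := hφ (φ.symm ⟨j, h⟩)
        simp only [Equiv.apply_symm_apply] at h1
        simp only [f, g, h, Sum.elim_inr, dif_pos]
        refine (dist_triangle _ (a j : ℝ × ℝ) _).trans (add_le_add ?_ (hab j))
        exact (congrArg (dist _) h1).trans_le (hcd _)
      · simp only [f, g, h, Sum.elim_inr, dif_neg, not_false_eq_true]
        exact (hab j).trans (le_add_of_nonneg_left hr0)

lemma bottleneck_xi_le {n : ℕ} (μ : PersDiag) {a b : Fin n → triangle n} {δ : ℝ}
    (hδ : 0 ≤ δ) (hab : ∀ j, dist (a j) (b j) ≤ δ) :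
    bottleneck μ (xi n b) ≤ bottleneck μ (xi n a) + δ := by
  simp only [bottleneck_eq_sInf]
  rcases (matchingCosts μ (xi n a)).eq_empty_or_nonempty with h | h
  · have hb : matchingCosts μ (xi n b) = ∅ := by
      refine Set.eq_empty_of_forall_notMem fun r hr => ?_
      obtain ⟨r', hr', -⟩ := exists_matchingCosts_xi_le (b := a) hr hδ
        fun j => (dist_comm _ _).trans_le (hab j)
      exact (h ▸ hr' : r' ∈ (∅ : Set ℝ))
    simpa [h, hb] using hδ
  · rw [← sub_le_iff_le_add]
    refine le_csInf h fun r hr => ?_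
    obtain ⟨r', hr', hle⟩ := exists_matchingCosts_xi_le hr hδ hab
    exact sub_le_iff_le_add.2 ((csInf_le (bddBelow_matchingCosts _ _) hr').trans hle)

/-- the map `ξₙ : (X̂ₙ)ⁿ → 𝒟ₙ` is continuous, where `(X̂ₙ)ⁿ` carries the
Euclidean product topology and `𝒟ₙ` the topology of the bottleneck metric. -/
theorem xi_continuous (n : ℕ) (hn : 1 ≤ n) :
    Continuous (fun a : Fin n → (triangle n) => (⟨xi n a, xi_mem_DD n a⟩ : DD n)) := by
  refine Continuous.subtype_mk (continuous_generateFrom_iff.2 ?_) _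
  rintro _ ⟨μ, ε, -, rfl⟩
  refine Metric.isOpen_iff.2 fun a (ha : bottleneck μ (xi n a) < ε) => ?_
  refine ⟨ε - bottleneck μ (xi n a), sub_pos.2 ha, fun b hb => ?_⟩
  have hle := bottleneck_xi_le μ (dist_nonneg (x := a) (y := b)) fun j => dist_le_pi_dist a b j
  rw [Metric.mem_ball, dist_comm] at hb
  exact hle.trans_lt (by linarith)
end
end

section
/- For every n ∈ ℕ, the space 𝒟_n with the bottleneck metric is an absolute retract for metrizable spaces; in particular it has the following extension property: for every metric space A, every closed subset B ⊆ A, and every continuous map f : B → 𝒟_n, there exists a continuous map g : A → 𝒟_n with g|_B = f. -/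
noncomputable section

open Set hiding offDiag
open Filter Topology MeasureTheory

section SupDist

lemma supDist_nonneg_s6 (p q : ℝ × ℝ) : 0 ≤ supDist p q :=
  le_max_of_le_left (abs_nonneg _)

lemma supDist_self (p : ℝ × ℝ) : supDist p p = 0 := by simp [supDist]

lemma supDist_comm_s6 (p q : ℝ × ℝ) : supDist p q = supDist q p := by
  simp only [supDist, abs_sub_comm]

lemma supDist_lt_iff {p q : ℝ × ℝ} {r : ℝ} :
    supDist p q < r ↔ |p.1 - q.1| < r ∧ |p.2 - q.2| < r := max_lt_iff

lemma supDist_triangle (p q u : ℝ × ℝ) : supDist p u ≤ supDist p q + supDist q u := by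
  simp only [supDist]
  refine max_le ?_ ?_
  · exact (abs_sub_le _ q.1 _).trans (add_le_add (le_max_left _ _) (le_max_left _ _))
  · exact (abs_sub_le _ q.2 _).trans (add_le_add (le_max_right _ _) (le_max_right _ _))

/-- The nearest point of the diagonal for the sup-norm. -/
def diagProj (p : ℝ × ℝ) : ℝ × ℝ := ((p.1 + p.2) / 2, (p.1 + p.2) / 2)

/-- The closed half-triangle `X ∪ Δ`. -/
def closedHalf : Set (ℝ × ℝ) := {p | 0 ≤ p.1 ∧ p.1 ≤ p.2}

lemma mem_offDiag_union_diagSet {p : ℝ × ℝ} : p ∈ offDiag ∪ diagSet ↔ p ∈ closedHalf := by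
  simp only [offDiag, diagSet, closedHalf, mem_union, mem_ofPred_eq, le_iff_lt_or_eq (a := p.1)]
  tauto

lemma offDiag_subset_closedHalf : offDiag ⊆ closedHalf := fun _ h => ⟨h.1, h.2.le⟩

lemma diagSet_subset_closedHalf : diagSet ⊆ closedHalf := fun _ h => ⟨h.1, h.2.le⟩

lemma mem_diagSet_of_notMem_offDiag {p : ℝ × ℝ} (h : p ∈ closedHalf) (h' : p ∉ offDiag) :
    p ∈ diagSet :=
  (mem_offDiag_union_diagSet.2 h).resolve_left h'

lemma notMem_offDiag_of_mem_diagSet {p : ℝ × ℝ} (h : p ∈ diagSet) : p ∉ offDiag :=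
  fun h' => h'.2.ne h.2

lemma diagProj_mem_diagSet {p : ℝ × ℝ} (h : p ∈ closedHalf) : diagProj p ∈ diagSet :=
  ⟨by have := h.1; have := h.2; simp only [diagProj]; linarith, rfl⟩

lemma supDist_diagProj {p : ℝ × ℝ} (h : p ∈ closedHalf) :
    supDist p (diagProj p) = (p.2 - p.1) / 2 := by
  have h2 := h.2
  have e1 : p.1 - (p.1 + p.2) / 2 = -((p.2 - p.1) / 2) := by ring
  have e2 : p.2 - (p.1 + p.2) / 2 = (p.2 - p.1) / 2 := by ring
  simp only [supDist, diagProj, e1, e2, abs_neg, max_self]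
  exact abs_of_nonneg (by linarith)

end SupDist

lemma Multiset.Rel.comp {α β γ : Type*} {r : α → β → Prop} {r' : β → γ → Prop}
    {r'' : α → γ → Prop} (hr : ∀ a b c, r a b → r' b c → r'' a c) {s : Multiset α}
    {t : Multiset β} {u : Multiset γ} (h : Multiset.Rel r s t) (h' : Multiset.Rel r' t u) :
    Multiset.Rel r'' s u := by
  induction h generalizing u with
  | zero =>
    rw [Multiset.rel_zero_left] at h'
    subst h'
    exact Multiset.Rel.zero
  | cons hab _ ih =>
    obtain ⟨c, u', hbc, hu', rfl⟩ := Multiset.rel_cons_left.1 h'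
    exact Multiset.Rel.cons (hr _ _ _ hab hbc) (ih hu')

lemma Multiset.Rel.exists_fin {α β : Type*} {r : α → β → Prop} {s : Multiset α}
    {t : Multiset β} (h : Multiset.Rel r s t) :
    ∃ (k : ℕ) (a : Fin k → α) (b : Fin k → β), Finset.univ.val.map a = s ∧
      Finset.univ.val.map b = t ∧ ∀ i, r (a i) (b i) := by
  induction h with
  | zero => exact ⟨0, Fin.elim0, Fin.elim0, rfl, rfl, fun i => i.elim0⟩
  | @cons x y s t hxy _ ih =>
    obtain ⟨k, a, b, rfl, rfl, hab⟩ := ih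
    refine ⟨k + 1, Fin.cons x a, Fin.cons y b, ?_, ?_, ?_⟩
    · simp [Fin.univ_succ, Function.comp_def]
    · simp [Fin.univ_succ, Function.comp_def]
    · intro i
      refine Fin.cases ?_ ?_ i
      · simpa using hxy
      · intro j
        simpa using hab j

open scoped Classical in
/-- The multiset of off-diagonal points of a persistence diagram. -/
def PersDiag.points (μ : PersDiag) : Multiset (ℝ × ℝ) :=
  ∑ p ∈ μ.finite_support.toFinset, Multiset.replicate (μ.toFun p) p

namespace PersDiag

open scoped Classical in
lemma count_points (μ : PersDiag) (p : ℝ × ℝ) : μ.points.count p = μ.toFun p := by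
  rw [points, Multiset.count_sum']
  simp only [Multiset.count_replicate]
  rw [Finset.sum_ite_eq']
  simp only [Finite.mem_toFinset, Function.mem_support]
  split_ifs with h
  · rfl
  · exact (not_not.1 h).symm

lemma mem_points {μ : PersDiag} {p : ℝ × ℝ} :
    p ∈ μ.points ↔ p ∈ Function.support μ.toFun := by
  classical
  rw [← Multiset.count_ne_zero, count_points, Function.mem_support]

lemma mem_offDiag_of_mem_points {μ : PersDiag} {p : ℝ × ℝ} (h : p ∈ μ.points) : p ∈ offDiag :=
  μ.support_subset (mem_points.1 h)

@[ext] lemma ext' {μ ν : PersDiag} (h : μ.points = ν.points) : μ = ν := by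
  classical
  have : μ.toFun = ν.toFun := funext fun p => by rw [← count_points, ← count_points, h]
  cases μ
  cases ν
  cases this
  rfl

open scoped Classical in
/-- The persistence diagram of the off-diagonal terms of a multiset of points. -/
def ofPoints (M : Multiset (ℝ × ℝ)) : PersDiag where
  toFun p := (M.filter (· ∈ offDiag)).count p
  finite_support := M.toFinset.finite_toSet.subset fun p hp => by
    have : p ∈ M.filter (· ∈ offDiag) := Multiset.count_ne_zero.1 hp
    simpa using (Multiset.mem_filter.1 this).1
  support_subset p hp := by
    have : p ∈ M.filter (· ∈ offDiag) := Multiset.count_ne_zero.1 hp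
    exact (Multiset.mem_filter.1 this).2

open scoped Classical in
lemma points_ofPoints (M : Multiset (ℝ × ℝ)) :
    (ofPoints M).points = M.filter (· ∈ offDiag) := by
  ext p
  rw [count_points]
  rfl

lemma ofPoints_points_add (μ : PersDiag) {S : Multiset (ℝ × ℝ)} (hS : ∀ p ∈ S, p ∉ offDiag) :
    ofPoints (μ.points + S) = μ := by
  classical
  ext1
  rw [points_ofPoints, Multiset.filter_add, Multiset.filter_eq_nil.2 hS, add_zero,
    Multiset.filter_eq_self.2 fun p hp => mem_offDiag_of_mem_points hp]

lemma ofPoints_points (μ : PersDiag) : ofPoints μ.points = μ := by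
  simpa using ofPoints_points_add μ (S := 0) (by simp)

lemma exists_points_ofPoints_add {M : Multiset (ℝ × ℝ)} (hM : ∀ p ∈ M, p ∈ closedHalf) :
    ∃ S : Multiset (ℝ × ℝ), (∀ p ∈ S, p ∈ diagSet) ∧ (ofPoints M).points + S = M := by
  classical
  refine ⟨M.filter (· ∉ offDiag), fun p hp => ?_, ?_⟩
  · rw [Multiset.mem_filter] at hp
    exact mem_diagSet_of_notMem_offDiag (hM p hp.1) hp.2
  · rw [points_ofPoints, Multiset.filter_add_not]

end PersDiag

open PersDiag

lemma isSeqRep_iff {μ : PersDiag} {k : ℕ} {a : Fin k → ℝ × ℝ} :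
    IsSeqRep μ a ↔ (∀ i, a i ∈ closedHalf) ∧ ofPoints (Finset.univ.val.map a) = μ := by
  classical
  simp only [IsSeqRep, mem_offDiag_union_diagSet]
  refine and_congr_right fun _ => ?_
  have key : ∀ p ∈ offDiag, {i : Fin k | a i = p}.ncard =
      (ofPoints (Finset.univ.val.map a)).toFun p := fun p hp => by
    rw [← count_points, points_ofPoints, Multiset.count_filter_of_pos hp, Multiset.count_map,
      Set.ncard_eq_toFinset_card']
    simp only [Finset.card, toFinset_ofPred, Finset.filter_val, eq_comm]
  constructor
  · intro h
    ext1
    ext p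
    rw [count_points, count_points]
    by_cases hp : p ∈ offDiag
    · rw [← key p hp, h p hp]
    · have h0 : ∀ κ : PersDiag, κ.toFun p = 0 := fun κ =>
        not_not.1 fun h => hp (κ.support_subset h)
      rw [h0, h0]
  · rintro rfl
    exact key

/-- Two diagrams are matched at scale `r` if, after adding diagonal points, their points can be
paired so that paired points are at distance less than `r`. -/
def Matched (r : ℝ) (μ ν : PersDiag) : Prop :=
  ∃ S T : Multiset (ℝ × ℝ), (∀ p ∈ S, p ∈ diagSet) ∧ (∀ p ∈ T, p ∈ diagSet) ∧
    Multiset.Rel (fun p q => supDist p q < r) (μ.points + S) (ν.points + T)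

namespace Matched

lemma refl {r : ℝ} (hr : 0 < r) (μ : PersDiag) : Matched r μ μ :=
  ⟨0, 0, by simp, by simp, Multiset.rel_refl_of_refl_on fun p _ => by rwa [supDist_self]⟩

lemma symm {r : ℝ} {μ ν : PersDiag} (h : Matched r μ ν) : Matched r ν μ := by
  obtain ⟨S, T, hS, hT, h⟩ := h
  refine ⟨T, S, hT, hS, Multiset.rel_flip.1 (h.mono fun p _ q _ hpq => ?_)⟩
  simpa only [flip, supDist_comm_s6] using hpq

lemma trans {r r' : ℝ} {μ ν κ : PersDiag} (hr : 0 < r) (hr' : 0 < r') (h : Matched r μ ν)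
    (h' : Matched r' ν κ) : Matched (r + r') μ κ := by
  obtain ⟨S, T, hS, hT, h⟩ := h
  obtain ⟨S', T', hS', hT', h'⟩ := h'
  refine ⟨S + S', T' + T, ?_, ?_, ?_⟩
  · simpa only [Multiset.mem_add] using fun p hp => hp.elim (hS p) (hS' p)
  · simpa only [Multiset.mem_add] using fun p hp => hp.elim (hT' p) (hT p)
  · have h1 := h.add (Multiset.rel_refl_of_refl_on (m := S') fun p _ => by
      rwa [supDist_self] : Multiset.Rel (fun p q => supDist p q < r) S' S')
    have h2 := h'.add (Multiset.rel_refl_of_refl_on (m := T) fun p _ => by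
      rwa [supDist_self] : Multiset.Rel (fun p q => supDist p q < r') T T)
    rw [add_right_comm ν.points S' T] at h2
    rw [← add_assoc, ← add_assoc]
    exact h1.comp (fun p q u hpq hqu =>
      (supDist_triangle p q u).trans_lt (add_lt_add hpq hqu)) h2

lemma nonempty_seqRep {r : ℝ} {μ ν : PersDiag} (h : Matched r μ ν) :
    ∃ (k : ℕ) (a b : Fin k → ℝ × ℝ), IsSeqRep μ a ∧ IsSeqRep ν b ∧
      ∀ i, supDist (a i) (b i) < r := by
  obtain ⟨S, T, hS, hT, h⟩ := h
  obtain ⟨k, a, b, ha, hb, hab⟩ := h.exists_fin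
  have key : ∀ (κ : PersDiag) (c : Fin k → ℝ × ℝ) (U : Multiset (ℝ × ℝ)),
      (∀ p ∈ U, p ∈ diagSet) → Finset.univ.val.map c = κ.points + U → IsSeqRep κ c := by
    intro κ c U hU hc
    refine isSeqRep_iff.2 ⟨fun i => ?_, ?_⟩
    · have hi : c i ∈ κ.points + U := hc ▸ Multiset.mem_map_of_mem c (Finset.mem_univ_val i)
      rcases Multiset.mem_add.1 hi with hi | hi
      · exact offDiag_subset_closedHalf (mem_offDiag_of_mem_points hi)
      · exact diagSet_subset_closedHalf (hU _ hi)
    · rw [hc, ofPoints_points_add κ fun p hp => notMem_offDiag_of_mem_diagSet (hU p hp)]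
  exact ⟨k, a, b, key μ a S hS ha, key ν b T hT hb, hab⟩

end Matched

lemma matched_ofPoints {r : ℝ} {M N : Multiset (ℝ × ℝ)} (hM : ∀ p ∈ M, p ∈ closedHalf)
    (hN : ∀ p ∈ N, p ∈ closedHalf) (h : Multiset.Rel (fun p q => supDist p q < r) M N) :
    Matched r (ofPoints M) (ofPoints N) := by
  obtain ⟨S, hS, hS'⟩ := exists_points_ofPoints_add hM
  obtain ⟨T, hT, hT'⟩ := exists_points_ofPoints_add hN
  exact ⟨S, T, hS, hT, by rwa [hS', hT']⟩

lemma matched_of_seqRep {r : ℝ} {μ ν : PersDiag} {k : ℕ} {a b : Fin k → ℝ × ℝ}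
    (ha : IsSeqRep μ a) (hb : IsSeqRep ν b) (σ : Equiv.Perm (Fin k))
    (h : ∀ i, supDist (a i) (b (σ i)) < r) : Matched r μ ν := by
  rw [isSeqRep_iff] at ha hb
  have hσ : Finset.univ.val.map (b ∘ σ) = Finset.univ.val.map b := by
    rw [← Multiset.map_map]
    congr 1
    exact congrArg Finset.val (Finset.map_univ_equiv σ)
  rw [← ha.2, ← hb.2, ← hσ]
  refine matched_ofPoints ?_ ?_ ?_
  · simpa using ha.1
  · simpa using fun i => hb.1 (σ i)
  · rw [Multiset.rel_map]
    exact Multiset.rel_refl_of_refl_on fun i _ => h i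

lemma exists_matched_of_card (μ ν : PersDiag) : ∃ r, Matched r μ ν := by
  have h : Multiset.Rel (fun _ _ : ℝ × ℝ => True)
      (μ.points + Multiset.replicate ν.points.card (0, 0))
      (ν.points + Multiset.replicate μ.points.card (0, 0)) :=
    Multiset.rel_of_forall (fun _ _ _ _ => trivial) (by simp [add_comm])
  obtain ⟨k, a, b, ha, hb, -⟩ := h.exists_fin
  refine ⟨(⨆ i, supDist (a i) (b i)) + 1, Multiset.replicate ν.points.card (0, 0),
    Multiset.replicate μ.points.card (0, 0), ?_, ?_, ?_⟩
  rotate_left 2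
  · rw [← ha, ← hb, Multiset.rel_map]
    exact Multiset.rel_refl_of_refl_on fun i _ =>
      (le_ciSup (Set.finite_range fun i => supDist (a i) (b i)).bddAbove i).trans_lt
        (lt_add_one _)
  all_goals
    intro p hp
    rw [Multiset.eq_of_mem_replicate hp]
    exact ⟨le_rfl, rfl⟩

lemma bottleneck_le_of_matched {r : ℝ} (hr : 0 ≤ r) {μ ν : PersDiag} (h : Matched r μ ν) :
    bottleneck μ ν ≤ r := by
  obtain ⟨k, a, b, ha, hb, hab⟩ := h.nonempty_seqRep
  have h : bottleneck μ ν ≤ ⨆ i, supDist (a i) (b i) := by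
    refine csInf_le ⟨0, ?_⟩ ⟨k, a, b, 1, ha, hb, rfl⟩
    rintro _ ⟨k, a, b, σ, -, -, rfl⟩
    exact Real.iSup_nonneg fun i => supDist_nonneg_s6 _ _
  exact h.trans (Real.iSup_le (fun i => (hab i).le) hr)

lemma matched_of_bottleneck_lt {r : ℝ} {μ ν : PersDiag} (h : bottleneck μ ν < r) :
    Matched r μ ν := by
  obtain ⟨_, ⟨k, a, b, σ, ha, hb, rfl⟩, hr⟩ := exists_lt_of_csInf_lt (by
    obtain ⟨r', h'⟩ := exists_matched_of_card μ ν
    obtain ⟨k, a, b, ha, hb, -⟩ := h'.nonempty_seqRep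
    exact ⟨_, k, a, b, 1, ha, hb, rfl⟩) h
  exact matched_of_seqRep ha hb σ fun i =>
    (le_ciSup (Set.finite_range fun i => supDist (a i) (b (σ i))).bddAbove i).trans_lt hr

lemma bottleneck_nonneg (μ ν : PersDiag) : 0 ≤ bottleneck μ ν :=
  Real.sInf_nonneg (by
    rintro _ ⟨k, a, b, σ, -, -, rfl⟩
    exact Real.iSup_nonneg fun i => supDist_nonneg_s6 _ _)

lemma bottleneck_self (μ : PersDiag) : bottleneck μ μ = 0 :=
  le_antisymm (le_of_forall_pos_le_add fun ε hε => by
    simpa using bottleneck_le_of_matched hε.le (Matched.refl hε μ)) (bottleneck_nonneg μ μ)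

lemma bottleneck_comm (μ ν : PersDiag) : bottleneck μ ν = bottleneck ν μ := by
  have key : ∀ μ ν, bottleneck μ ν ≤ bottleneck ν μ := fun μ ν =>
    le_of_forall_pos_le_add fun ε hε => bottleneck_le_of_matched
      (add_nonneg (bottleneck_nonneg _ _) hε.le)
      (matched_of_bottleneck_lt (lt_add_of_pos_right _ hε)).symm
  exact le_antisymm (key μ ν) (key ν μ)

lemma bottleneck_triangle (μ ν κ : PersDiag) :
    bottleneck μ κ ≤ bottleneck μ ν + bottleneck ν κ := by
  refine le_of_forall_pos_le_add fun ε hε => ?_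
  have h1 := bottleneck_nonneg μ ν
  have h2 := bottleneck_nonneg ν κ
  have := bottleneck_le_of_matched (by linarith) (Matched.trans (by linarith) (by linarith)
    (matched_of_bottleneck_lt (lt_add_of_pos_right (bottleneck μ ν) (half_pos hε)))
    (matched_of_bottleneck_lt (lt_add_of_pos_right (bottleneck ν κ) (half_pos hε))))
  linarith

/-- Diagrams in `𝒟ₙ` are at bounded distance from each other. -/
lemma bottleneck_le_of_mem_DD {n : ℕ} {μ ν : PersDiag} (hμ : μ ∈ DD n) (hν : ν ∈ DD n) :
    bottleneck μ ν ≤ 2 * (n + 1) := by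
  have key : ∀ κ ∈ DD n, bottleneck κ (ofPoints 0) ≤ n + 1 := by
    intro κ hκ
    refine bottleneck_le_of_matched (by positivity) ⟨0, κ.points.map diagProj, by simp, ?_, ?_⟩
    · simp only [Multiset.mem_map]
      rintro _ ⟨p, hp, rfl⟩
      exact diagProj_mem_diagSet (offDiag_subset_closedHalf (mem_offDiag_of_mem_points hp))
    · simp only [points_ofPoints, Multiset.filter_zero, zero_add, add_zero]
      rw [Multiset.rel_map_right]
      refine Multiset.rel_refl_of_refl_on fun p hp => ?_
      have h1 := hκ.2 (mem_points.1 hp)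
      rw [supDist_diagProj ⟨h1.1, h1.2.1⟩]
      have := h1.1
      have := h1.2.1
      have := h1.2.2
      linarith
  have := bottleneck_triangle μ (ofPoints 0) ν
  rw [bottleneck_comm (ofPoints 0) ν] at this
  linarith [key μ hμ, key ν hν]

section Topology

lemma continuousAt_persDiag_iff {Y : Type*} [TopologicalSpace Y] {g : Y → PersDiag} {x : Y} :
    ContinuousAt g x ↔ ∀ ε > 0, ∀ᶠ y in 𝓝 x, bottleneck (g x) (g y) < ε := by
  constructor
  · intro h ε hε
    refine h.eventually (IsOpen.mem_nhds (TopologicalSpace.isOpen_generateFrom_of_mem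
      ⟨g x, ε, hε, rfl⟩) ?_)
    rwa [mem_ofPred_eq, bottleneck_self]
  · intro h
    refine TopologicalSpace.tendsto_nhds_generateFrom_iff.2 ?_
    rintro _ ⟨μ, ε, hε, rfl⟩ hx
    filter_upwards [h _ (sub_pos.2 hx)] with y hy
    have := bottleneck_triangle μ (g x) (g y)
    simp only [mem_preimage, mem_ofPred_eq]
    linarith

end Topology

section Push

lemma ofPoints_map_mem_DD {n : ℕ} {μ : PersDiag} (hμ : μ ∈ DD n) {θ : ℝ × ℝ → ℝ × ℝ}
    (hθ : ∀ p ∈ triangle n, θ p ∈ triangle n) : ofPoints (μ.points.map θ) ∈ DD n := by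
  classical
  have key : Function.support (ofPoints (μ.points.map θ)).toFun ⊆
      θ '' Function.support μ.toFun := by
    intro p hp
    rw [← mem_points, points_ofPoints, Multiset.mem_filter, Multiset.mem_map] at hp
    obtain ⟨⟨q, hq, rfl⟩, -⟩ := hp
    exact ⟨q, mem_points.1 hq, rfl⟩
  refine ⟨((ncard_le_ncard key (μ.finite_support.image θ)).trans
    (ncard_image_le μ.finite_support)).trans hμ.1, key.trans ?_⟩
  rintro _ ⟨q, hq, rfl⟩
  exact hθ q (hμ.2 hq)

lemma bottleneck_ofPoints_map_le {r : ℝ} (hr : 0 ≤ r) (M : Multiset (ℝ × ℝ))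
    {θ θ' : ℝ × ℝ → ℝ × ℝ} (hθ : ∀ p ∈ M, θ p ∈ closedHalf) (hθ' : ∀ p ∈ M, θ' p ∈ closedHalf)
    (h : ∀ p ∈ M, supDist (θ p) (θ' p) < r) :
    bottleneck (ofPoints (M.map θ)) (ofPoints (M.map θ')) ≤ r := by
  refine bottleneck_le_of_matched hr (matched_ofPoints ?_ ?_ ?_)
  · simpa only [Multiset.forall_mem_map_iff] using hθ
  · simpa only [Multiset.forall_mem_map_iff] using hθ'
  · rw [Multiset.rel_map]
    exact Multiset.rel_refl_of_refl_on h

lemma ofPoints_eq_of_rel {M N : Multiset (ℝ × ℝ)}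
    (h : Multiset.Rel (fun p q => p = q ∨ p ∉ offDiag ∧ q ∉ offDiag) M N) :
    ofPoints M = ofPoints N := by
  classical
  ext1
  simp only [points_ofPoints]
  induction h with
  | zero => rfl
  | cons hab _ ih =>
    rcases hab with rfl | ⟨h1, h2⟩
    · simp only [Multiset.filter_cons, ih]
    · simp only [Multiset.filter_cons, ih, h1, h2, if_false]

lemma ofPoints_map_eq_of_matched {r : ℝ} {μ ν : PersDiag} (h : Matched r μ ν)
    {θ : ℝ × ℝ → ℝ × ℝ} (hθ : ∀ p ∈ diagSet, θ p ∉ offDiag)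
    (hθ' : ∀ p q, (p ∈ μ.points ∨ p ∈ diagSet) → (q ∈ ν.points ∨ q ∈ diagSet) →
      supDist p q < r → θ p = θ q ∨ θ p ∉ offDiag ∧ θ q ∉ offDiag) :
    ofPoints (μ.points.map θ) = ofPoints (ν.points.map θ) := by
  classical
  obtain ⟨S, T, hS, hT, h⟩ := h
  have key : ∀ (κ : PersDiag) (U : Multiset (ℝ × ℝ)), (∀ p ∈ U, p ∈ diagSet) →
      ofPoints ((κ.points + U).map θ) = ofPoints (κ.points.map θ) := by
    intro κ U hU
    ext1
    rw [points_ofPoints, points_ofPoints, Multiset.map_add, Multiset.filter_add,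
      Multiset.filter_eq_nil (s := U.map θ) |>.2, add_zero]
    simpa only [Multiset.forall_mem_map_iff] using fun p hp => hθ p (hU p hp)
  rw [← key μ S hS, ← key ν T hT]
  refine ofPoints_eq_of_rel (Multiset.rel_map.2 (h.mono fun p hp q hq hpq => ?_))
  exact hθ' p q ((Multiset.mem_add.1 hp).imp_right (hS p))
    ((Multiset.mem_add.1 hq).imp_right (hT q)) hpq

end Push

lemma Matched.exists_near {r : ℝ} {μ ν : PersDiag} (h : Matched r μ ν) {p : ℝ × ℝ}
    (hp : p ∈ μ.points) (hpr : 2 * r ≤ p.2 - p.1) : ∃ q ∈ ν.points, supDist p q < r := by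
  obtain ⟨S, T, -, hT, h⟩ := h
  obtain ⟨q, hq, hpq⟩ := Multiset.exists_mem_of_rel_of_mem h (Multiset.mem_add.2 (Or.inl hp))
  refine ⟨q, (Multiset.mem_add.1 hq).resolve_right fun hq => ?_, hpq⟩
  obtain ⟨h1, h2⟩ := supDist_lt_iff.1 hpq
  have := (hT q hq).2
  rw [abs_lt] at h1 h2
  linarith

section Collapse

/-- The length of the part of `[0, t]` outside `U`. -/
def squeeze (U : Set ℝ) (t : ℝ) : ℝ := volume.real (Icc 0 t \ U)

lemma volume_Icc_diff_ne_top (U : Set ℝ) (a b : ℝ) : volume (Icc a b \ U) ≠ ⊤ :=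
  measure_ne_top_of_subset sdiff_subset (by simp)

lemma squeeze_nonneg (U : Set ℝ) (t : ℝ) : 0 ≤ squeeze U t := measureReal_nonneg

lemma squeeze_mono (U : Set ℝ) : Monotone (squeeze U) := fun _ _ h =>
  measureReal_mono (sdiff_subset_sdiff_left (Icc_subset_Icc_right h)) (volume_Icc_diff_ne_top U _ _)

lemma squeeze_le (U : Set ℝ) {t : ℝ} (ht : 0 ≤ t) : squeeze U t ≤ t := by
  have h : squeeze U t ≤ volume.real (Icc 0 t) := measureReal_mono sdiff_subset (by simp)
  simpa [ht] using h

lemma le_squeeze_add {U : Set ℝ} {V t : ℝ} (hV : 0 ≤ V) (hU : volume U ≤ ENNReal.ofReal V)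
    (ht : 0 ≤ t) : t ≤ squeeze U t + V := by
  have h1 : volume.real (Icc 0 t) ≤ squeeze U t + volume.real U :=
    (measureReal_mono (by rw [sdiff_union_self]; exact subset_union_left)
      (measure_union_ne_top (volume_Icc_diff_ne_top U 0 t)
        (ne_top_of_le_ne_top ENNReal.ofReal_ne_top hU))).trans (measureReal_union_le _ _)
  have h2 : volume.real U ≤ V := ENNReal.toReal_le_of_le_ofReal hV hU
  have h3 : volume.real (Icc 0 t) = t := by simp [ht]
  linarith

lemma squeeze_eq_of_uIcc_subset {U : Set ℝ} {a b : ℝ} (h : uIcc a b ⊆ U) :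
    squeeze U a = squeeze U b := by
  have key : ∀ {a b : ℝ}, uIcc a b ⊆ U → Icc 0 b \ U ⊆ Icc 0 a \ U := by
    rintro a b h x ⟨⟨hx0, hxb⟩, hxU⟩
    refine ⟨⟨hx0, not_lt.1 fun hax => hxU (h ?_)⟩, hxU⟩
    exact Icc_subset_uIcc ⟨hax.le, hxb⟩
  exact congrArg volume.real ((key (uIcc_comm a b ▸ h)).antisymm (key h))

lemma tendsto_squeeze {ι : Type*} {l : Filter ι} [l.IsCountablyGenerated] {U : ι → Set ℝ}
    {U₀ : Set ℝ} (hU : ∀ i, MeasurableSet (U i)) (hU₀ : MeasurableSet U₀)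
    (h : ∀ᵐ u, ∀ᶠ i in l, u ∈ U i ↔ u ∈ U₀) (t : ℝ) :
    Tendsto (fun i => squeeze (U i) t) l (𝓝 (squeeze U₀ t)) := by
  refine (ENNReal.tendsto_toReal (volume_Icc_diff_ne_top U₀ 0 t)).comp ?_
  refine tendsto_measure_of_ae_tendsto_indicator l (measurableSet_Icc.diff hU₀)
    (fun i => measurableSet_Icc.diff (hU i)) (measurableSet_Icc (a := (0 : ℝ)) (b := t))
    (by simp) (Eventually.of_forall fun i => sdiff_subset) ?_
  filter_upwards [h] with u hu
  filter_upwards [hu] with i hi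
  simp only [Set.mem_sdiff, hi]

/-- Squeeze out the coordinates in `U` and then shrink towards the diagonal by `r`. -/
def collapse (U : Set ℝ) (r : ℝ) (p : ℝ × ℝ) : ℝ × ℝ :=
  (squeeze U p.1 + min r ((squeeze U p.2 - squeeze U p.1) / 2),
    squeeze U p.2 - min r ((squeeze U p.2 - squeeze U p.1) / 2))

variable {U : Set ℝ} {r : ℝ} {p q : ℝ × ℝ}

lemma collapse_mem_closedHalf (hr : 0 ≤ r) (hp : p ∈ closedHalf) :
    collapse U r p ∈ closedHalf := by
  have h1 := squeeze_nonneg U p.1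
  have h2 := squeeze_mono U hp.2
  have h3 := min_le_right r ((squeeze U p.2 - squeeze U p.1) / 2)
  have h4 : 0 ≤ min r ((squeeze U p.2 - squeeze U p.1) / 2) := le_min hr (by linarith)
  constructor <;> simp only [collapse] <;> linarith

lemma collapse_mem_triangle {n : ℕ} (hr : 0 ≤ r) (hp : p ∈ triangle n) :
    collapse U r p ∈ triangle n := by
  have h := collapse_mem_closedHalf (U := U) hr (p := p) ⟨hp.1, hp.2.1⟩
  refine ⟨h.1, h.2, ?_⟩
  have h2 := squeeze_mono U hp.2.1
  have h4 : 0 ≤ min r ((squeeze U p.2 - squeeze U p.1) / 2) := le_min hr (by linarith)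
  have h5 := squeeze_le U (hp.1.trans hp.2.1)
  have := hp.2.2
  simp only [collapse]
  linarith

lemma collapse_notMem_offDiag (hp : p ∈ closedHalf)
    (h : p.2 - p.1 ≤ 2 * r) : collapse U r p ∉ offDiag := by
  have h1 : squeeze U p.2 ≤ squeeze U p.1 + (p.2 - p.1) := by
    have hsub : Icc 0 p.2 \ U ⊆ (Icc 0 p.1 \ U) ∪ Icc p.1 p.2 := by
      rintro x ⟨⟨hx0, hx2⟩, hxU⟩
      rcases le_total x p.1 with h | h
      · exact Or.inl ⟨⟨hx0, h⟩, hxU⟩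
      · exact Or.inr ⟨h, hx2⟩
    have h2 : volume.real (Icc p.1 p.2) = p.2 - p.1 := by simp [hp.2]
    rw [← h2]
    exact (measureReal_mono hsub (measure_union_ne_top (volume_Icc_diff_ne_top U _ _)
      (by simp))).trans (measureReal_union_le _ _)
  rintro ⟨-, h2⟩
  rw [collapse, min_eq_right (by linarith)] at h2
  simp only at h2
  linarith

lemma collapse_eq_of_uIcc_subset (h₁ : uIcc p.1 q.1 ⊆ U) (h₂ : uIcc p.2 q.2 ⊆ U) :
    collapse U r p = collapse U r q := by
  simp only [collapse, squeeze_eq_of_uIcc_subset h₁, squeeze_eq_of_uIcc_subset h₂]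

lemma supDist_collapse_le {V : ℝ} (hV : 0 ≤ V) (hU : volume U ≤ ENNReal.ofReal V) (hr : 0 ≤ r)
    (hp : p ∈ closedHalf) : supDist (collapse U r p) p ≤ V + r := by
  have h1 := squeeze_le U hp.1
  have h2 := squeeze_le U (hp.1.trans hp.2)
  have h3 := le_squeeze_add hV hU hp.1
  have h4 := le_squeeze_add hV hU (hp.1.trans hp.2)
  have h5 := squeeze_mono U hp.2
  have h6 := min_le_left r ((squeeze U p.2 - squeeze U p.1) / 2)
  have h7 : 0 ≤ min r ((squeeze U p.2 - squeeze U p.1) / 2) := le_min hr (by linarith)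
  refine max_le (abs_le.2 ?_) (abs_le.2 ?_) <;> constructor <;> simp only [collapse] <;> linarith

lemma tendsto_supDist_collapse {ι : Type*} {l : Filter ι} [l.IsCountablyGenerated]
    {U : ι → Set ℝ} {U₀ : Set ℝ} {r : ι → ℝ} {r₀ : ℝ} (hU : ∀ i, MeasurableSet (U i))
    (hU₀ : MeasurableSet U₀) (h : ∀ᵐ u, ∀ᶠ i in l, u ∈ U i ↔ u ∈ U₀)
    (hr : Tendsto r l (𝓝 r₀)) (p : ℝ × ℝ) :
    Tendsto (fun i => supDist (collapse U₀ r₀ p) (collapse (U i) (r i) p)) l (𝓝 0) := by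
  have h1 := tendsto_squeeze hU hU₀ h p.1
  have h2 := tendsto_squeeze hU hU₀ h p.2
  have h3 := hr.min ((h2.sub h1).div_const 2)
  have h4 := ((tendsto_const_nhds (x := (collapse U₀ r₀ p).1)).sub (h1.add h3)).abs.max
    ((tendsto_const_nhds (x := (collapse U₀ r₀ p).2)).sub (h2.sub h3)).abs
  simpa [collapse, supDist] using h4

end Collapse

section Absorbed

/-- The radius of the neighbourhoods absorbed around the coordinates of a point `p`, for the weight
`w` and the scale `s`. It vanishes at points close to the diagonal. -/
def thickness (w s : ℝ) (p : ℝ × ℝ) : ℝ := w * max 0 (min s ((p.2 - p.1) / 2 - 2 * s))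

/-- The union of the neighbourhoods of the coordinates of all points of the diagrams `m i`. -/
def absorbed {ι : Type*} (m : ι → PersDiag) (w : ι → ℝ) (s : ℝ) : Set ℝ :=
  {u | ∃ i, ∃ p ∈ (m i).points, |u - p.1| < thickness (w i) s p ∨ |u - p.2| < thickness (w i) s p}

variable {ι : Type*} {m : ι → PersDiag} {w : ι → ℝ} {s : ℝ}

lemma isOpen_absorbed : IsOpen (absorbed m w s) := by
  simp only [absorbed, ofPred_exists]
  refine isOpen_iUnion fun i => isOpen_iUnion fun p => isOpen_const.and (IsOpen.union ?_ ?_)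
  · exact isOpen_lt (f := fun u => |u - p.1|) (by fun_prop) continuous_const
  · exact isOpen_lt (f := fun u => |u - p.2|) (by fun_prop) continuous_const

lemma measurableSet_absorbed : MeasurableSet (absorbed m w s) := isOpen_absorbed.measurableSet

lemma ball_subset_absorbed {i : ι} (hi : w i = 1) {p : ℝ × ℝ} (hp : p ∈ (m i).points)
    (hs : 0 ≤ s) (hps : 6 * s ≤ p.2 - p.1) {u : ℝ} (hu : |u - p.1| < s ∨ |u - p.2| < s) :
    u ∈ absorbed m w s := by
  have : thickness (w i) s p = s := by
    rw [thickness, hi, min_eq_left (by linarith), max_eq_right hs, one_mul]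
  exact ⟨i, p, hp, by rwa [this]⟩

lemma ofPoints_map_collapse_eq {j j' : ι} (hj' : w j' = 1) (hs : 0 < s)
    (h : Matched s (m j) (m j')) :
    ofPoints ((m j).points.map (collapse (absorbed m w s) (4 * s))) =
      ofPoints ((m j').points.map (collapse (absorbed m w s) (4 * s))) := by
  refine ofPoints_map_eq_of_matched h (fun p hp => ?_) fun p q hp hq hpq => ?_
  · refine collapse_notMem_offDiag (diagSet_subset_closedHalf hp) ?_
    have := hp.2
    linarith
  · have hp' : p ∈ closedHalf := hp.elim
      (fun h => offDiag_subset_closedHalf (mem_offDiag_of_mem_points h))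
      fun h => diagSet_subset_closedHalf h
    have hq' : q ∈ closedHalf := hq.elim
      (fun h => offDiag_subset_closedHalf (mem_offDiag_of_mem_points h))
      fun h => diagSet_subset_closedHalf h
    obtain ⟨h1, h2⟩ := supDist_lt_iff.1 hpq
    rcases lt_or_ge (q.2 - q.1) (6 * s) with hqs | hqs
    · rw [abs_lt] at h1 h2
      exact Or.inr ⟨collapse_notMem_offDiag hp' (by linarith),
        collapse_notMem_offDiag hq' (by linarith)⟩
    · refine Or.inl (collapse_eq_of_uIcc_subset ?_ ?_)
      all_goals
        have hqm : q ∈ (m j').points := hq.resolve_right fun h => by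
          have := h.2
          linarith
        intro u hu
        refine ball_subset_absorbed hj' hqm hs.le hqs ?_
      · exact Or.inl (by
          rw [abs_sub_comm]
          exact (abs_sub_right_of_mem_uIcc hu).trans_lt (by rwa [abs_sub_comm]))
      · exact Or.inr (by
          rw [abs_sub_comm]
          exact (abs_sub_right_of_mem_uIcc hu).trans_lt (by rwa [abs_sub_comm]))

lemma thickness_le {w s : ℝ} (hw : w ≤ 1) (hs : 0 ≤ s) (p : ℝ × ℝ) : thickness w s p ≤ s :=
  (mul_le_of_le_one_left (le_max_left _ _) hw).trans (max_le hs (min_le_left _ _))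

lemma volume_absorbed_le {n : ℕ} {ν : PersDiag} (hν : ν ∈ DD n) (hs : 0 ≤ s) (hw : ∀ i, w i ≤ 1)
    (h : ∀ i, w i ≠ 0 → Matched s (m i) ν) :
    volume (absorbed m w s) ≤ ENNReal.ofReal (8 * n * s) := by
  classical
  set F := ν.finite_support.toFinset with hF
  have hcard : F.card ≤ n := by
    rw [hF, ← Set.ncard_eq_toFinset_card _ ν.finite_support]
    exact hν.1
  have hsub : absorbed m w s ⊆
      ⋃ q ∈ F, Metric.ball q.1 (2 * s) ∪ Metric.ball q.2 (2 * s) := by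
    rintro u ⟨i, p, hp, hu⟩
    have hτ : 0 < thickness (w i) s p :=
      hu.elim (fun h => (abs_nonneg _).trans_lt h) fun h => (abs_nonneg _).trans_lt h
    have hwi : w i ≠ 0 := by
      rintro h0
      simp [thickness, h0] at hτ
    have hps : 2 * s ≤ p.2 - p.1 := by
      by_contra! hlt
      rw [thickness, max_eq_left ((min_le_right _ _).trans (by linarith)), mul_zero] at hτ
      exact lt_irrefl _ hτ
    obtain ⟨q, hq, hpq⟩ := (h i hwi).exists_near hp hps
    have hle := thickness_le (hw i) hs p
    obtain ⟨h1, h2⟩ := supDist_lt_iff.1 hpq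
    simp only [mem_iUnion, Set.mem_union, Metric.mem_ball, Real.dist_eq]
    refine ⟨q, by simpa [hF] using mem_points.1 hq, hu.imp (fun hu => ?_) fun hu => ?_⟩
    · linarith [abs_sub_le u p.1 q.1]
    · linarith [abs_sub_le u p.2 q.2]
  have hball : ∀ c : ℝ, volume (Metric.ball c (2 * s)) = ENNReal.ofReal (4 * s) := fun c => by
    rw [Real.volume_ball]
    ring_nf
  calc volume (absorbed m w s)
      ≤ ∑ q ∈ F, volume (Metric.ball q.1 (2 * s) ∪ Metric.ball q.2 (2 * s)) :=
        (measure_mono hsub).trans (measure_biUnion_finset_le _ _)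
    _ ≤ ∑ q ∈ F, ENNReal.ofReal (8 * s) := by
        refine Finset.sum_le_sum fun q _ => (measure_union_le _ _).trans ?_
        rw [hball, hball, ← ENNReal.ofReal_add (by linarith) (by linarith)]
        exact ENNReal.ofReal_le_ofReal (by linarith)
    _ = ENNReal.ofReal (F.card * (8 * s)) := by
        rw [Finset.sum_const, nsmul_eq_mul, ENNReal.ofReal_mul (Nat.cast_nonneg _),
          ENNReal.ofReal_natCast]
    _ ≤ ENNReal.ofReal (8 * n * s) := by
        refine ENNReal.ofReal_le_ofReal ?_
        have : (F.card : ℝ) ≤ n := by exact_mod_cast hcard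
        nlinarith

lemma ae_eventually_mem_absorbed_iff {Y : Type*} [TopologicalSpace Y] {w : Y → ι → ℝ} {s : Y → ℝ}
    {x₀ : Y} {F : Set ι} (hF : F.Finite) (hwF : ∀ᶠ x in 𝓝 x₀, ∀ i ∉ F, w x i = 0)
    (hw : ∀ i, ContinuousAt (fun x => w x i) x₀) (hs : ContinuousAt s x₀) :
    ∀ᵐ u, ∀ᶠ x in 𝓝 x₀, u ∈ absorbed m (w x) (s x) ↔ u ∈ absorbed m (w x₀) (s x₀) := by
  have hτ : ∀ i p, ContinuousAt (fun x => thickness (w x i) (s x) p) x₀ := fun i p =>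
    (hw i).mul (continuousAt_const.max (hs.min (continuousAt_const.sub (hs.const_mul 2))))
  have hbad : ∀ c r : ℝ, {u : ℝ | |u - c| = r}.Finite := fun c r => by
    refine (Set.toFinite {c + r, c - r}).subset fun u hu => ?_
    simp only [mem_insert_iff, mem_singleton_iff]
    have hu : |u - c| = r := hu
    rcases abs_cases (u - c) with h | h
    · left; linarith
    · right; linarith
  have hN : (⋃ i ∈ F, ⋃ p ∈ Function.support (m i).toFun,
      {u : ℝ | |u - p.1| = thickness (w x₀ i) (s x₀) p} ∪
        {u : ℝ | |u - p.2| = thickness (w x₀ i) (s x₀) p}).Finite :=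
    hF.biUnion fun i _ => (m i).finite_support.biUnion fun p _ => (hbad _ _).union (hbad _ _)
  filter_upwards [compl_mem_ae_iff.2 (hN.measure_zero volume)] with u hu
  simp only [mem_compl_iff, mem_iUnion, Set.mem_union, mem_ofPred_eq, not_exists, not_or] at hu
  have hlt : ∀ {c : ℝ} {i : ι} {p : ℝ × ℝ}, c ≠ thickness (w x₀ i) (s x₀) p →
      ∀ᶠ x in 𝓝 x₀, c < thickness (w x i) (s x) p ↔ c < thickness (w x₀ i) (s x₀) p := by
    intro c i p hc
    rcases hc.lt_or_gt with h | h
    · filter_upwards [(hτ i p).eventually (lt_mem_nhds h)] with x hx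
      exact iff_of_true hx h
    · filter_upwards [(hτ i p).eventually (gt_mem_nhds h)] with x hx
      exact iff_of_false hx.not_gt h.not_gt
  have hall : ∀ᶠ x in 𝓝 x₀, ∀ i ∈ F, ∀ p ∈ Function.support (m i).toFun,
      (|u - p.1| < thickness (w x i) (s x) p ↔ |u - p.1| < thickness (w x₀ i) (s x₀) p) ∧
      (|u - p.2| < thickness (w x i) (s x) p ↔ |u - p.2| < thickness (w x₀ i) (s x₀) p) := by
    refine (eventually_all_finite hF).2 fun i hi =>
      (eventually_all_finite (m i).finite_support).2 fun p hp => ?_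
    exact (hlt (hu i hi p hp).1).and (hlt (hu i hi p hp).2)
  have hzero : ∀ (c t : ℝ) (p : ℝ × ℝ), ¬ |c| < thickness 0 t p := fun c t p => by
    simp [thickness]
  filter_upwards [hall, hwF] with x hx hxF
  refine exists_congr fun i => exists_congr fun p => and_congr_right fun hp => ?_
  by_cases hi : i ∈ F
  · have := hx i hi p (mem_points.1 hp)
    rw [this.1, this.2]
  · simp [hxF i hi, hwF.self_of_nhds i hi, hzero]

end Absorbed

section Extension

open Metric

variable {A : Type*} [MetricSpace A] {B : Set A}

lemma exists_bump_near (hB : IsClosed B) (hne : B.Nonempty) :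
    ∃ (w : ↥Bᶜ → ↥Bᶜ → ℝ) (c : ↥Bᶜ → B), (∀ x i, w x i ≤ 1) ∧
      (∀ i, Continuous fun x => w x i) ∧
      (∀ x₀, ∃ F : Set ↥Bᶜ, F.Finite ∧ ∀ᶠ x in 𝓝 x₀, ∀ i ∉ F, w x i = 0) ∧
      (∀ x₀, ∃ j, ∀ᶠ x in 𝓝 x₀, w x j = 1) ∧
      ∀ (x : ↥Bᶜ) i, w x i ≠ 0 → dist (x : A) (c i) < 3 * infDist (x : A) B := by
  have hpos : ∀ x : ↥Bᶜ, 0 < infDist (x : A) B := fun x =>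
    (hB.notMem_iff_infDist_pos hne).1 x.2
  have hc : ∀ i : ↥Bᶜ, ∃ c : B, dist (i : A) c < 2 * infDist (i : A) B := fun i => by
    obtain ⟨c, hc, h⟩ := (infDist_lt_iff hne).1 (lt_two_mul_self (hpos i))
    exact ⟨⟨c, hc⟩, h⟩
  choose c hc using hc
  obtain ⟨ψ, hψ⟩ := BumpCovering.exists_isSubordinate (X := ↥Bᶜ) isClosed_univ
    (fun i => ball i (infDist (i : A) B / 4)) (fun i => isOpen_ball) fun x _ =>
      mem_iUnion.2 ⟨x, mem_ball_self (by have := hpos x; positivity)⟩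
  refine ⟨fun x i => ψ i x, c, fun x i => ψ.le_one i x, fun i => (ψ i).continuous, fun x₀ => ?_,
    fun x₀ => ⟨ψ.ind x₀ (mem_univ _), ψ.eventuallyEq_one x₀ (mem_univ _)⟩, fun x i hi => ?_⟩
  · obtain ⟨t, ht, hfin⟩ := ψ.locallyFinite x₀
    refine ⟨_, hfin, ?_⟩
    filter_upwards [ht] with x hx i hi
    by_contra h
    exact hi ⟨x, h, hx⟩
  · have h1 : dist (x : A) i < infDist (i : A) B / 4 := hψ i (subset_tsupport _ hi)
    have h2 := infDist_le_infDist_add_dist (s := B) (x := (i : A)) (y := x)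
    rw [dist_comm] at h2
    linarith [hc i, dist_triangle (x : A) i (c i)]

lemma exists_scale {n : ℕ} (hB : IsClosed B) (hne : B.Nonempty) {F : B → PersDiag}
    (hF : ∀ b, F b ∈ DD n) : ∃ s : C(↥Bᶜ, ℝ), (∀ x, 0 < s x) ∧
      (∀ x : ↥Bᶜ, ∀ c c' : B, dist (x : A) c < 3 * infDist (x : A) B →
        dist (x : A) c' < 3 * infDist (x : A) B → bottleneck (F c) (F c') < s x) ∧
      ∀ (x : ↥Bᶜ) (e : ℝ), 0 ≤ e → (∀ c c' : B, dist (x : A) c < 8 * infDist (x : A) B →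
        dist (x : A) c' < 8 * infDist (x : A) B → bottleneck (F c) (F c') ≤ e) →
        s x ≤ e + 2 * infDist (x : A) B := by
  have hpos : ∀ x : ↥Bᶜ, 0 < infDist (x : A) B := fun x =>
    (hB.notMem_iff_infDist_pos hne).1 x.2
  let t : ↥Bᶜ → Set ℝ := fun x => {r | 0 < r ∧
      (∀ c c' : B, dist (x : A) c < 3 * infDist (x : A) B →
        dist (x : A) c' < 3 * infDist (x : A) B → bottleneck (F c) (F c') < r) ∧
      ∀ e : ℝ, 0 ≤ e → (∀ c c' : B, dist (x : A) c < 8 * infDist (x : A) B →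
        dist (x : A) c' < 8 * infDist (x : A) B → bottleneck (F c) (F c') ≤ e) →
        r ≤ e + 2 * infDist (x : A) B}
  have ht : ∀ x, Convex ℝ (t x) := fun x => by
    refine Set.OrdConnected.convex ⟨fun a ha b hb r hr => ⟨ha.1.trans_le hr.1, ?_, ?_⟩⟩
    · exact fun c c' hc hc' => (ha.2.1 c c' hc hc').trans_le hr.1
    · exact fun e he h => hr.2.trans (hb.2.2 e he h)
  obtain ⟨s, hs⟩ := exists_continuous_forall_mem_convex_of_local_const ht fun x₀ => by
    set D : Set ℝ := {r | ∃ c c' : B, dist (x₀ : A) c < 5 * infDist (x₀ : A) B ∧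
      dist (x₀ : A) c' < 5 * infDist (x₀ : A) B ∧ bottleneck (F c) (F c') = r} with hD
    have hbdd : BddAbove D := ⟨2 * (n + 1), by
      rintro _ ⟨c, c', -, -, rfl⟩
      exact bottleneck_le_of_mem_DD (hF c) (hF c')⟩
    have hD0 : 0 ≤ sSup D := Real.sSup_nonneg (by
      rintro _ ⟨c, c', -, -, rfl⟩
      exact bottleneck_nonneg _ _)
    have h0 := hpos x₀
    refine ⟨sSup D + infDist (x₀ : A) B, ?_⟩
    filter_upwards [ball_mem_nhds x₀ (show 0 < infDist (x₀ : A) B / 4 by positivity)] with x hx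
    have hx : dist (x : A) x₀ < infDist (x₀ : A) B / 4 := hx
    have h1 := infDist_le_infDist_add_dist (s := B) (x := (x : A)) (y := x₀)
    have h2 := infDist_le_infDist_add_dist (s := B) (x := (x₀ : A)) (y := x)
    rw [dist_comm] at h2
    refine ⟨by positivity, fun c c' hc hc' => ?_, fun e he h => ?_⟩
    · have hle : bottleneck (F c) (F c') ≤ sSup D := le_csSup hbdd ⟨c, c', by
        linarith [dist_triangle_left (x₀ : A) c x], by
        linarith [dist_triangle_left (x₀ : A) c' x], rfl⟩
      linarith
    · have hle : sSup D ≤ e := Real.sSup_le (by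
        rintro _ ⟨c, c', hc, hc', rfl⟩
        exact h c c' (by linarith [dist_triangle (x : A) x₀ c])
          (by linarith [dist_triangle (x : A) x₀ c'])) he
      linarith
  exact ⟨s, fun x => (hs x).1, fun x => (hs x).2.1, fun x => (hs x).2.2⟩

/-- A continuous map on the complement of `B` which is close to `F` near `B`. -/
lemma exists_continuous_compl {n : ℕ} (hB : IsClosed B) (hne : B.Nonempty) {F : B → PersDiag}
    (hF : ∀ b, F b ∈ DD n) : ∃ g : ↥Bᶜ → PersDiag, (∀ x, g x ∈ DD n) ∧ Continuous g ∧
      ∀ (x : ↥Bᶜ) (e : ℝ), 0 ≤ e → (∀ c c' : B, dist (x : A) c < 8 * infDist (x : A) B →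
        dist (x : A) c' < 8 * infDist (x : A) B → bottleneck (F c) (F c') ≤ e) →
        ∃ c : B, dist (x : A) c < 3 * infDist (x : A) B ∧
          bottleneck (F c) (g x) ≤ (8 * n + 5) * (e + 2 * infDist (x : A) B) := by
  obtain ⟨w, c, hw1, hwc, hwF, hwj, hwd⟩ := exists_bump_near hB hne
  obtain ⟨s, hs0, hs1, hs2⟩ := exists_scale hB hne hF
  have hm : ∀ (x : ↥Bᶜ) {i j}, w x i ≠ 0 → w x j ≠ 0 → Matched (s x) (F (c i)) (F (c j)) :=
    fun x i j hi hj => matched_of_bottleneck_lt (hs1 x _ _ (hwd x i hi) (hwd x j hj))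
  let Θ : ↥Bᶜ → ℝ × ℝ → ℝ × ℝ := fun x =>
    collapse (absorbed (fun i => F (c i)) (w x) (s x)) (4 * s x)
  have hs4 : ∀ x, 0 ≤ 4 * s x := fun x => by linarith [hs0 x]
  have hj : ∀ x, ∃ j, w x j = 1 := fun x => (hwj x).imp fun j hj => hj.self_of_nhds
  choose J hJ using hj
  have hJ0 : ∀ x, w x (J x) ≠ 0 := fun x => by simp [hJ x]
  let g : ↥Bᶜ → PersDiag := fun x => ofPoints ((F (c (J x))).points.map (Θ x))
  have hg : ∀ x j, w x j = 1 → g x = ofPoints ((F (c j)).points.map (Θ x)) := fun x j hj =>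
    ofPoints_map_collapse_eq hj (hs0 x) (hm x (hJ0 x) (by simp [hj]))
  have hpts : ∀ {b : B} {p : ℝ × ℝ}, p ∈ (F b).points → p ∈ closedHalf := fun hp =>
    offDiag_subset_closedHalf (mem_offDiag_of_mem_points hp)
  refine ⟨g, fun x => ofPoints_map_mem_DD (hF _) fun p hp => collapse_mem_triangle (hs4 x) hp,
    continuous_iff_continuousAt.2 fun x₀ => continuousAt_persDiag_iff.2 fun ε hε => ?_,
    fun x e he h => ⟨c (J x), hwd x _ (hJ0 x), ?_⟩⟩
  · obtain ⟨j, hj⟩ := hwj x₀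
    obtain ⟨K, hK, hwK⟩ := hwF x₀
    have key : ∀ p, ∀ᶠ x in 𝓝 x₀, supDist (Θ x₀ p) (Θ x p) < ε / 2 := fun p =>
      (tendsto_supDist_collapse (fun _ => measurableSet_absorbed) measurableSet_absorbed
        (ae_eventually_mem_absorbed_iff hK hwK (fun i => (hwc i).continuousAt)
          s.continuous.continuousAt) (s.continuous.tendsto x₀ |>.const_mul 4) p).eventually
        (gt_mem_nhds (half_pos hε))
    filter_upwards [hj, (eventually_all_finite (F (c j)).finite_support).2 fun p _ => key p]
      with x hx hxp
    rw [hg x₀ j hj.self_of_nhds, hg x j hx]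
    refine (bottleneck_ofPoints_map_le (half_pos hε).le _
      (fun p hp => collapse_mem_closedHalf (hs4 _) (hpts hp))
      (fun p hp => collapse_mem_closedHalf (hs4 _) (hpts hp))
      fun p hp => hxp p (mem_points.1 hp)).trans_lt (half_lt_self hε)
  · have hs := hs0 x
    have hV : 0 ≤ 8 * n * s x := by positivity
    have hn : (0 : ℝ) ≤ 8 * n + 5 := by positivity
    have hvol := volume_absorbed_le (hF (c (J x))) hs.le (hw1 x) fun i hi => hm x hi (hJ0 x)
    have h1 : bottleneck (ofPoints ((F (c (J x))).points.map id)) (g x) ≤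
        (8 * n + 5) * s x := by
      refine bottleneck_ofPoints_map_le (by positivity) _ (fun p hp => hpts hp)
        (fun p hp => collapse_mem_closedHalf (hs4 _) (hpts hp)) fun p hp => ?_
      rw [id, supDist_comm_s6]
      refine (supDist_collapse_le hV hvol (hs4 x) (hpts hp)).trans_lt ?_
      linarith
    rw [Multiset.map_id, ofPoints_points] at h1
    exact h1.trans (mul_le_mul_of_nonneg_left (hs2 x e he h) hn)

lemma exists_extension {n : ℕ} (hB : IsClosed B) (hne : B.Nonempty) {F : B → PersDiag}
    (hF : ∀ b, F b ∈ DD n) (hFc : Continuous F) :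
    ∃ g : A → PersDiag, (∀ x, g x ∈ DD n) ∧ Continuous g ∧ ∀ b : B, g b = F b := by
  classical
  obtain ⟨g, hg, hgc, hgF⟩ := exists_continuous_compl hB hne hF
  let G : A → PersDiag := fun x => if h : x ∈ B then F ⟨x, h⟩ else g ⟨x, h⟩
  have hGB : ∀ b : B, G b = F b := fun b => dif_pos b.2
  have hGc : ∀ x : ↥Bᶜ, G x = g x := fun x => dif_neg x.2
  refine ⟨G, fun x => ?_, continuous_iff_continuousAt.2 fun x => ?_, hGB⟩
  · by_cases h : x ∈ B
    · exact hGB ⟨x, h⟩ ▸ hF _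
    · exact hGc ⟨x, h⟩ ▸ hg _
  by_cases hx : x ∈ B
  swap
  · refine (hB.isOpen_compl.isOpenEmbedding_subtypeVal.continuousAt_iff (x := ⟨x, hx⟩)).1 ?_
    have : G ∘ Subtype.val = g := funext hGc
    rw [this]
    exact hgc.continuousAt
  lift x to B using hx
  refine continuousAt_persDiag_iff.2 fun ε hε => ?_
  rw [hGB]
  have hC : (0 : ℝ) < 8 * n + 5 := by positivity
  obtain ⟨κ, hκ, hκε⟩ : ∃ κ > 0, κ + (8 * n + 5) * (2 * κ + 2 * κ) < ε := by
    refine ⟨ε / (2 * (1 + 4 * (8 * n + 5))), by positivity, ?_⟩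
    have : ε / (2 * (1 + 4 * (8 * n + 5))) + (8 * n + 5) *
        (2 * (ε / (2 * (1 + 4 * (8 * n + 5)))) + 2 * (ε / (2 * (1 + 4 * (8 * n + 5))))) =
        ε / 2 := by
      field_simp
      ring
    linarith
  obtain ⟨η, hη, hηκ⟩ := Metric.eventually_nhds_iff.1
    (continuousAt_persDiag_iff.1 (hFc.continuousAt (x := x)) κ hκ)
  filter_upwards [ball_mem_nhds (x : A) (show 0 < min κ (η / 9) by positivity)] with y hy
  obtain ⟨hy1, hy2⟩ := lt_min_iff.1 (mem_ball.1 hy)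
  by_cases hyB : y ∈ B
  · lift y to B using hyB
    rw [hGB]
    have := hηκ (y := y) (by
      have : dist (y : A) x < η := by linarith
      exact this)
    nlinarith
  · lift y to ↥Bᶜ using hyB
    rw [hGc]
    have hδ := infDist_le_dist_of_mem (x := (y : A)) x.2
    have hnear : ∀ c : B, dist (y : A) c < 8 * infDist (y : A) B →
        bottleneck (F x) (F c) < κ := fun c hc => hηκ (by
      have : dist (c : A) x < η := by linarith [dist_triangle_left (c : A) x y]
      exact this)
    obtain ⟨c, hc, hcg⟩ := hgF y (2 * κ) (by positivity) fun c c' hc hc' => by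
      have := bottleneck_triangle (F c) (F x) (F c')
      rw [bottleneck_comm (F c) (F x)] at this
      linarith [hnear c hc, hnear c' hc']
    have h1 := hnear c (by linarith [infDist_nonneg (x := (y : A)) (s := B)])
    have h2 : (8 * n + 5) * (2 * κ + 2 * infDist (y : A) B) ≤
        (8 * n + 5) * (2 * κ + 2 * κ) :=
      mul_le_mul_of_nonneg_left (by linarith) hC.le
    linarith [bottleneck_triangle (F x) (F c) (g y)]

end Extension

/-- `𝒟ₙ` (with the bottleneck-metric topology) is an absolute retract for
metrizable spaces: for every metric space `A`, every closed subset `B ⊆ A` and every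
continuous `f : B → 𝒟ₙ`, there is a continuous `g : A → 𝒟ₙ` extending `f`. -/
theorem DD_absolute_retract (n : ℕ) (A : Type*) [MetricSpace A]
    (B : Set A) (hB : IsClosed B) (f : B → DD n) (hf : Continuous f) :
    ∃ g : A → DD n, Continuous g ∧ ∀ b : B, g (b : A) = f b := by
  rcases B.eq_empty_or_nonempty with rfl | hne
  · have h0 : ofPoints 0 ∈ DD n := by
      have : Function.support (ofPoints 0).toFun = ∅ := by
        classical
        refine eq_empty_of_forall_notMem fun p hp => ?_
        rw [← mem_points, points_ofPoints] at hp
        simp at hp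
      rw [DD, mem_ofPred_eq, this]
      exact ⟨by simp, empty_subset _⟩
    exact ⟨fun _ => ⟨_, h0⟩, continuous_const, fun b => b.2.elim⟩
  · obtain ⟨g, hg, hgc, hgf⟩ := exists_extension hB hne (fun b => (f b).2)
      (continuous_subtype_val.comp hf)
    exact ⟨fun x => ⟨g x, hg x⟩, hgc.subtype_mk hg, fun b => Subtype.ext (hgf b)⟩
end
end
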